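/- Let a > 0, b > 0, c > 0 and 2 ≤ α < β with β > 2, and define f(z) = a z² + b z^α − c z^β for z ∈ (0, ∞). Then f attains its maximum on (0, ∞) at a unique point z₀ > 0, and f″(z₀) < 0. -/

import Mathlib

open Set

noncomputable section

/-- The function `f(z) = a z² + b z^α − c z^β` (with real-power exponents). -/
def powFun (a b c α β : ℝ) : ℝ → ℝ :=
  fun z => a * z ^ 2 + b * z ^ α - c * z ^ β

/-- The factor `h` in the factorization `f'(z) = z^(β - 1) h(z)` of the derivative of `powFun`. -/
def powFunFactor (a b c α β : ℝ) : ℝ → ℝ :=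
  fun z => 2 * a * z ^ (2 - β) + b * α * z ^ (α - β) - c * β

lemma hasDerivAt_powFun (a b c α β : ℝ) {z : ℝ} (hz : 0 < z) :
    HasDerivAt (powFun a b c α β) (z ^ (β - 1) * powFunFactor a b c α β z) z := by
  have h := (((hasDerivAt_pow 2 z).const_mul a).add
    ((Real.hasDerivAt_rpow_const (p := α) (Or.inl hz.ne')).const_mul b)).sub
    ((Real.hasDerivAt_rpow_const (p := β) (Or.inl hz.ne')).const_mul c)
  refine h.congr_deriv ?_
  have h₁ : z ^ (β - 1) * z ^ (2 - β) = z := by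
    rw [← Real.rpow_add hz]; ring_nf; exact Real.rpow_one z
  have h₂ : z ^ (β - 1) * z ^ (α - β) = z ^ (α - 1) := by
    rw [← Real.rpow_add hz]; ring_nf
  simp only [powFunFactor]
  push_cast
  linear_combination (-2 * a) * h₁ - b * α * h₂

lemma hasDerivAt_powFunFactor (a b c α β : ℝ) {z : ℝ} (hz : 0 < z) :
    HasDerivAt (powFunFactor a b c α β)
      (2 * a * ((2 - β) * z ^ (2 - β - 1)) + b * α * ((α - β) * z ^ (α - β - 1))) z :=
  (((Real.hasDerivAt_rpow_const (Or.inl hz.ne')).const_mul (2 * a)).add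
    ((Real.hasDerivAt_rpow_const (Or.inl hz.ne')).const_mul (b * α))).sub_const (c * β)

lemma strictAntiOn_powFunFactor {a b c α β : ℝ} (ha : 0 < a) (hb : 0 < b) (hα : 0 < α)
    (hαβ : α < β) (hβ : 2 < β) : StrictAntiOn (powFunFactor a b c α β) (Ioi 0) := by
  intro x hx y _ hxy
  have h₁ := Real.rpow_lt_rpow_of_neg hx hxy (sub_neg.2 hβ)
  have h₂ := Real.rpow_lt_rpow_of_neg hx hxy (sub_neg.2 hαβ)
  simp only [powFunFactor]
  gcongr

lemma exists_powFunFactor_eq_zero {a b c α β : ℝ} (ha : 0 < a) (hb : 0 < b) (hc : 0 < c)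
    (hα : 0 < α) (hαβ : α < β) (hβ : 2 < β) :
    ∃ z, 0 < z ∧ powFunFactor a b c α β z = 0 := by
  have hβ₀ : 0 < β := by linarith
  obtain ⟨x, hx, hfx⟩ : ∃ x, 0 < x ∧ 0 < powFunFactor a b c α β x := by
    have hq : 0 < c * β / (2 * a) := by positivity
    refine ⟨(c * β / (2 * a)) ^ (2 - β)⁻¹, by positivity, ?_⟩
    have h : 0 < b * α * ((c * β / (2 * a)) ^ (2 - β)⁻¹) ^ (α - β) := by positivity
    simp only [powFunFactor]
    rw [Real.rpow_inv_rpow hq.le (sub_neg.2 hβ).ne, mul_div_cancel₀ _ (by positivity)]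
    linarith
  have hlim : Filter.Tendsto (powFunFactor a b c α β) Filter.atTop
      (nhds (2 * a * 0 + b * α * 0 - c * β)) := by
    have h₁ := tendsto_rpow_neg_atTop (sub_pos.2 hβ)
    have h₂ := tendsto_rpow_neg_atTop (sub_pos.2 hαβ)
    rw [neg_sub] at h₁ h₂
    exact ((h₁.const_mul _).add (h₂.const_mul _)).sub_const _
  have hneg : 2 * a * 0 + b * α * 0 - c * β < 0 := by
    have : 0 < c * β := by positivity
    linarith
  obtain ⟨y, hfy, hxy⟩ :=
    ((hlim.eventually_lt_const hneg).and (Filter.eventually_ge_atTop x)).exists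
  have hcont : ContinuousOn (powFunFactor a b c α β) (Icc x y) := fun z hz =>
    (hasDerivAt_powFunFactor a b c α β (hx.trans_le hz.1)).continuousAt.continuousWithinAt
  obtain ⟨z, hz, hfz⟩ := intermediate_value_Icc' hxy hcont ⟨hfy.le, hfx.le⟩
  exact ⟨z, hx.trans_le hz.1, hfz⟩

/-- if `a, b, c > 0` and `2 ≤ α < β` with `β > 2`, then `f` attains its
maximum on `(0, ∞)` at a unique point `z₀ > 0` and `f″(z₀) < 0`. -/
theorem statement4 (a b c α β : ℝ) (ha : 0 < a) (hb : 0 < b) (hc : 0 < c)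
    (hα : 2 ≤ α) (hαβ : α < β) (hβ : 2 < β) :
    ∃ z₀ : ℝ, 0 < z₀ ∧ IsMaxOn (powFun a b c α β) (Ioi 0) z₀ ∧
      (∀ z : ℝ, 0 < z → IsMaxOn (powFun a b c α β) (Ioi 0) z → z = z₀) ∧
      deriv (deriv (powFun a b c α β)) z₀ < 0 := by
  have hα₀ : 0 < α := by linarith
  obtain ⟨z₀, hz₀, hzero⟩ := exists_powFunFactor_eq_zero ha hb hc hα₀ hαβ hβ
  have hanti := strictAntiOn_powFunFactor (c := c) ha hb hα₀ hαβ hβ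
  have hcont : ContinuousOn (powFun a b c α β) (Ioi 0) := fun z hz =>
    (hasDerivAt_powFun a b c α β hz).continuousAt.continuousWithinAt
  have hleft : StrictMonoOn (powFun a b c α β) (Ioc 0 z₀) := by
    refine strictMonoOn_of_deriv_pos (convex_Ioc 0 z₀) (hcont.mono fun z hz => hz.1) ?_
    intro z hz
    rw [interior_Ioc] at hz
    rw [(hasDerivAt_powFun a b c α β hz.1).deriv]
    exact mul_pos (Real.rpow_pos_of_pos hz.1 _) (hzero ▸ hanti hz.1 hz₀ hz.2)
  have hright : StrictAntiOn (powFun a b c α β) (Ici z₀) := by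
    refine strictAntiOn_of_deriv_neg (convex_Ici z₀)
      (hcont.mono fun z hz => hz₀.trans_le hz) ?_
    intro z hz
    rw [interior_Ici] at hz
    have hz' : 0 < z := hz₀.trans hz
    rw [(hasDerivAt_powFun a b c α β hz').deriv]
    exact mul_neg_of_pos_of_neg (Real.rpow_pos_of_pos hz' _) (hzero ▸ hanti hz₀ hz' hz)
  have hlt : ∀ z, 0 < z → z ≠ z₀ → powFun a b c α β z < powFun a b c α β z₀ := by
    intro z hz hne
    rcases hne.lt_or_gt with h | h
    · exact hleft ⟨hz, h.le⟩ ⟨hz₀, le_rfl⟩ h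
    · exact hright self_mem_Ici h.le h
  refine ⟨z₀, hz₀, fun z hz => ?_, fun z hz hmax => ?_, ?_⟩
  · rcases eq_or_ne z z₀ with rfl | hne
    · exact le_refl (powFun a b c α β z)
    · exact (hlt z hz hne).le
  · by_contra hne
    exact (hlt z hz hne).not_ge (hmax hz₀)
  · have heq : deriv (powFun a b c α β) =ᶠ[nhds z₀]
        fun z => z ^ (β - 1) * powFunFactor a b c α β z := by
      filter_upwards [Ioi_mem_nhds hz₀] with z hz
      exact (hasDerivAt_powFun a b c α β hz).deriv
    have hderiv := (Real.hasDerivAt_rpow_const (p := β - 1) (Or.inl hz₀.ne')).fun_mul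
      (hasDerivAt_powFunFactor a b c α β hz₀)
    rw [heq.deriv_eq, hderiv.deriv, hzero, mul_zero, zero_add]
    refine mul_neg_of_pos_of_neg (by positivity) (add_neg ?_ ?_)
    · exact mul_neg_of_pos_of_neg (by positivity)
        (mul_neg_of_neg_of_pos (sub_neg.2 hβ) (by positivity))
    · exact mul_neg_of_pos_of_neg (by positivity)
        (mul_neg_of_neg_of_pos (sub_neg.2 hαβ) (by positivity))
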